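/- For every integer t with 0 ≤ t ≤ 8 and all integers n ≥ 0, a_{3t+2}(27n + r_t) ≡ a_{3t+2}(3n + s_t) (mod 3), where r_t = t if t is even and r_t = t + 9 if t is odd, and s_t = 0 if t is even and s_t = 1 if t is odd. -/

import Mathlib

/-- The set of `k`-colored-odd partitions of `n`: multisets of pairs `(m, c)` with
`m` a positive integer and `c ∈ {1, …, k}`, such that `c = 1` whenever `m` is even,
and the parts `m` sum (with multiplicity) to `n`. -/
def coloredOddPartitions (k n : ℕ) : Set (Multiset (ℕ × ℕ)) :=
  {s | (∀ p ∈ s, 0 < p.1 ∧ 1 ≤ p.2 ∧ p.2 ≤ k ∧ (Even p.1 → p.2 = 1)) ∧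
    (s.map Prod.fst).sum = n}

/-- `a k n` is the number of `k`-colored-odd partitions of `n`. -/
noncomputable def a (k n : ℕ) : ℕ := Nat.card (coloredOddPartitions k n)

namespace ColOdd
open PowerSeries Finset

/-- The finite `q`-Pochhammer product `(q; q)_n`. -/
def qp {R : Type*} [CommRing R] (q : R) (n : ℕ) : R := ∏ i ∈ range n, (1 - q ^ (i + 1))

/-- Gaussian binomial coefficients. -/
def qb {R : Type*} [CommRing R] (q : R) : ℕ → ℕ → R
  | _, 0 => 1
  | 0, _ + 1 => 0
  | n + 1, k + 1 => qb q n (k + 1) + q ^ (n - k) * qb q n k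

section gauss
variable {R : Type*} [CommRing R] (q : R)

lemma qb_zero (n : ℕ) : qb q n 0 = 1 := by cases n <;> rfl

lemma qb_succ (n k : ℕ) :
    qb q (n + 1) (k + 1) = qb q n (k + 1) + q ^ (n - k) * qb q n k := rfl

lemma qb_gt (n : ℕ) : ∀ k, n < k → qb q n k = 0 := by
  induction n with
  | zero => intro k hk; cases k with
    | zero => omega
    | succ k => rfl
  | succ n ih => intro k hk; cases k with
    | zero => omega
    | succ k => rw [qb_succ, ih _ (by omega), ih _ (by omega)]; simp

lemma qb_self (n : ℕ) : qb q n n = 1 := by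
  induction n with
  | zero => rfl
  | succ n ih => rw [qb_succ, ih, qb_gt q n _ (by omega)]; simp

lemma qb_succ' (n : ℕ) : ∀ k,
    qb q (n + 1) (k + 1) = qb q n k + q ^ (k + 1) * qb q n (k + 1) := by
  induction n with
  | zero => intro k; cases k with
    | zero => simp [qb]
    | succ k => simp [qb]
  | succ n ih =>
    intro k
    cases k with
    | zero =>
      rw [qb_succ, ih 0, qb_zero, qb_zero]
      have h := qb_succ q n 0
      rw [ih 0] at h
      simp only [qb_zero, Nat.sub_zero, zero_add, mul_one] at h ⊢
      linear_combination -q * h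
    | succ k =>
      have e1 := qb_succ q (n + 1) (k + 1)
      rw [ih (k + 1), ih k] at e1
      rw [e1, qb_succ q n k, qb_succ q n (k + 1)]
      clear e1
      rcases Nat.lt_or_ge n (k + 1) with h | h
      · rw [qb_gt q n (k + 1) h, qb_gt q n (k + 2) (by omega)]
        rw [show n + 1 - (k + 1) = n - k by omega]; ring
      · obtain ⟨m, rfl⟩ := Nat.exists_eq_add_of_le h
        rw [show k + 1 + m + 1 - (k + 1) = m + 1 by omega,
          show k + 1 + m - k = m + 1 by omega, show k + 1 + m - (k + 1) = m by omega]
        ring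

lemma qp_succ (n : ℕ) : qp q (n + 1) = qp q n * (1 - q ^ (n + 1)) := prod_range_succ _ _

lemma qb_mul (n : ℕ) : ∀ i j, i + j = n → qb q n i * (qp q i * qp q j) = qp q n := by
  induction n with
  | zero => intro i j h; obtain ⟨rfl, rfl⟩ : i = 0 ∧ j = 0 := by omega
            simp [qb, qp]
  | succ n ih =>
    intro i j h
    rcases i with _ | i
    · simp only [zero_add] at h; subst h; simp [qb_zero, qp]
    rcases j with _ | j
    · simp only [add_zero] at h; rw [h, qb_self]; simp [qp]
    have h1 := ih (i + 1) j (by omega)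
    have h2 := ih i (j + 1) (by omega)
    rw [qb_succ, show n - i = j + 1 by omega, qp_succ q n, qp_succ q j, qp_succ q i]
    rw [qp_succ] at h1 h2
    have : q ^ (n + 1) = q ^ (i + 1) * q ^ (j + 1) := by rw [← pow_add]; congr 1; omega
    rw [this]
    linear_combination (1 - q ^ (j + 1)) * h1 + q ^ (j + 1) * (1 - q ^ (i + 1)) * h2
end gauss

/-- triangular numbers indexed by integers -/
def tri (j : ℤ) : ℕ := (j * (j + 1) / 2).toNat

lemma tri_cast (j : ℤ) : 2 * (tri j : ℤ) = j * (j + 1) := by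
  unfold tri
  have h0 : 0 ≤ j * (j + 1) := by
    rcases le_or_gt 0 j with h | h
    · positivity
    · nlinarith
  have h2 : 2 ∣ j * (j + 1) := (Int.even_mul_succ_self j).two_dvd
  omega

lemma tri_succ (j : ℤ) : (tri (j + 1) : ℤ) = tri j + j + 1 := by
  have h1 := tri_cast j
  have h2 := tri_cast (j + 1)
  nlinarith

section jtp
variable {R : Type*} [CommRing R] (x y : R)

/-- terms of the theta series -/
def eterm (j : ℤ) : R := (-1) ^ j.natAbs * (x ^ tri (j - 1) * y ^ tri j)

lemma sgn_succ (j : ℤ) : (-1 : R) ^ (j + 1).natAbs = - (-1) ^ j.natAbs := by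
  rcases Nat.even_or_odd j.natAbs with h | h
  · have : Odd (j + 1).natAbs := by
      rw [Int.natAbs_odd]; rw [Int.natAbs_even] at h; exact h.add_one
    rw [h.neg_one_pow, this.neg_one_pow]
  · have : Even (j + 1).natAbs := by
      rw [Int.natAbs_even]; rw [Int.natAbs_odd] at h; exact h.add_one
    rw [h.neg_one_pow, this.neg_one_pow]; ring

lemma eterm_y (i d : ℕ) (j : ℤ) (h : (d : ℤ) = i - j) :
    x ^ i * y ^ (i + 1) * eterm x y j = - (x * y) ^ d * eterm x y (j + 1) := by
  unfold eterm
  rw [sgn_succ, add_sub_cancel_right]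
  have h1 := tri_succ (j - 1)
  have h2 := tri_succ j
  rw [sub_add_cancel] at h1
  have e1 : i + tri (j - 1) = d + tri j := by omega
  have e2 : i + 1 + tri j = d + tri (j + 1) := by omega
  have p1 : x ^ i * x ^ tri (j - 1) = x ^ d * x ^ tri j := by rw [← pow_add, ← pow_add, e1]
  have p2 : y ^ (i + 1) * y ^ tri j = y ^ d * y ^ tri (j + 1) := by
    rw [← pow_add, ← pow_add, e2]
  rw [mul_pow]
  calc _ = (-1) ^ j.natAbs * (x ^ i * x ^ tri (j - 1)) * (y ^ (i + 1) * y ^ tri j) := by ring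
    _ = _ := by rw [p1, p2]; ring

lemma eterm_x (i d : ℕ) (j : ℤ) (h : (d : ℤ) = i + 1 + j) :
    x ^ (i + 1) * y ^ i * eterm x y (j + 1) = - (x * y) ^ d * eterm x y j := by
  unfold eterm
  rw [sgn_succ, add_sub_cancel_right]
  have h1 := tri_succ (j - 1)
  have h2 := tri_succ j
  rw [sub_add_cancel] at h1
  have e1 : i + 1 + tri j = d + tri (j - 1) := by omega
  have e2 : i + tri (j + 1) = d + tri j := by omega
  have p1 : x ^ (i + 1) * x ^ tri j = x ^ d * x ^ tri (j - 1) := by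
    rw [← pow_add, ← pow_add, e1]
  have p2 : y ^ i * y ^ tri (j + 1) = y ^ d * y ^ tri j := by
    rw [← pow_add, ← pow_add, e2]
  rw [mul_pow]
  calc _ = - (-1) ^ j.natAbs * (x ^ (i + 1) * x ^ tri j) * (y ^ i * y ^ tri (j + 1)) := by ring
    _ = _ := by rw [p1, p2]; ring

/-- partial theta sums weighted by Gaussian binomials -/
def SS (n i : ℕ) : R := ∑ k ∈ range (n + 1), qb (x * y) n k * eterm x y ((k : ℤ) - i)

lemma SS_y (i : ℕ) : SS x y (2 * i + 1) i = SS x y (2 * i) i * (1 - x ^ i * y ^ (i + 1)) := by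
  have hA : SS x y (2 * i) i = ∑ k ∈ range (2 * i + 1),
      qb (x * y) (2 * i) (k + 1) * eterm x y (((k + 1 : ℕ) : ℤ) - i) + eterm x y (0 - i) := by
    unfold SS
    rw [sum_range_succ' , sum_range_succ _ (2 * i), qb_gt _ _ (2 * i + 1) (by omega), qb_zero]
    simp
  have hB : SS x y (2 * i + 1) i = ∑ k ∈ range (2 * i + 1),
      qb (x * y) (2 * i + 1) (k + 1) * eterm x y (((k + 1 : ℕ) : ℤ) - i) + eterm x y (0 - i) := by
    unfold SS
    rw [sum_range_succ', qb_zero]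
    simp
  rw [mul_sub, mul_one]
  nth_rewrite 1 [hA]
  rw [hB]
  unfold SS
  rw [sum_mul, add_sub_right_comm, ← sum_sub_distrib]
  congr 1
  apply sum_congr rfl
  intro k hk
  rw [mem_range] at hk
  have := eterm_y x y i (2 * i - k) ((k : ℤ) - i) (by omega)
  rw [qb_succ, show (((k + 1 : ℕ) : ℤ) - i) = (k : ℤ) - i + 1 by push_cast; ring]
  linear_combination qb (x * y) (2 * i) k * this

lemma SS_x (i : ℕ) :
    SS x y (2 * i + 2) (i + 1) = SS x y (2 * i + 1) i * (1 - x ^ (i + 1) * y ^ i) := by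
  have hA : SS x y (2 * i + 1) i = ∑ k ∈ range (2 * i + 2),
      qb (x * y) (2 * i + 1) (k + 1) * eterm x y (((k + 1 : ℕ) : ℤ) - i) + eterm x y (0 - i) := by
    unfold SS
    rw [sum_range_succ' , sum_range_succ _ (2 * i + 1), qb_gt _ _ (2 * i + 1 + 1) (by omega),
      qb_zero]
    simp
  have hB : SS x y (2 * i + 2) (i + 1) = ∑ k ∈ range (2 * i + 2),
      qb (x * y) (2 * i + 2) (k + 1) * eterm x y ((k : ℤ) - i) + eterm x y (0 - i - 1) := by
    unfold SS
    rw [sum_range_succ', qb_zero]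
    congr 1
    · apply sum_congr rfl; intro k _; congr 2; push_cast; ring
    · rw [one_mul]; congr 1; push_cast; ring
  have h0 := eterm_x x y i 0 (0 - i - 1) (by push_cast; ring)
  rw [sub_add_cancel] at h0
  rw [mul_sub, mul_one]
  nth_rewrite 2 [hA]
  rw [hB]
  unfold SS
  rw [add_mul, sum_mul, ← sub_sub, ← sum_sub_distrib, sub_eq_add_neg (∑ k ∈ range (2 * i + 1 + 1), _)]
  congr 1
  · apply sum_congr rfl
    intro k hk
    have := eterm_x x y i (k + 1) ((k : ℤ) - i) (by push_cast; ring)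
    rw [qb_succ', show (((k + 1 : ℕ) : ℤ) - i) = (k : ℤ) - i + 1 by push_cast; ring]
    linear_combination qb (x * y) (2 * i + 1) (k + 1) * this
  · linear_combination h0

lemma finite_jtp (N : ℕ) :
    SS x y (2 * N) N = ∏ i ∈ range N, ((1 - x ^ (i + 1) * y ^ i) * (1 - x ^ i * y ^ (i + 1))) := by
  induction N with
  | zero => simp [SS, qb, eterm, tri]
  | succ N ih =>
    rw [prod_range_succ, ← ih, show 2 * (N + 1) = 2 * N + 2 by ring, SS_x, SS_y]; ring
end jtp

section limits
variable {R : Type*} [CommRing R]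

lemma qp_congr (d : ℕ) (hd : 1 ≤ d) (k n : ℕ) (h : k ≤ n) :
    (X : R⟦X⟧) ^ (k + 1) ∣ qp ((X : R⟦X⟧) ^ d) n - qp (X ^ d) k := by
  induction n, h using Nat.le_induction with
  | base => simp
  | succ n hn ih =>
    have h2 : (X : R⟦X⟧) ^ (k + 1) ∣ (X ^ d) ^ (n + 1) := by
      rw [← pow_mul]; apply pow_dvd_pow; nlinarith
    rw [qp_succ, show qp ((X : R⟦X⟧) ^ d) n * (1 - (X ^ d) ^ (n + 1)) - qp (X ^ d) k =
      (qp (X ^ d) n - qp (X ^ d) k) - qp (X ^ d) n * (X ^ d) ^ (n + 1) by ring]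
    exact dvd_sub ih (h2.mul_left _)

lemma qp_const (d : ℕ) (hd : 1 ≤ d) (n : ℕ) :
    constantCoeff (qp ((X : R⟦X⟧) ^ d) n) = 1 := by
  unfold qp
  rw [map_prod]
  apply prod_eq_one
  intro i _
  rw [map_sub, map_pow, map_pow, constantCoeff_X, zero_pow (by omega), zero_pow (by omega)]
  simp

lemma qp_unit (d : ℕ) (hd : 1 ≤ d) (n : ℕ) : IsUnit (qp ((X : R⟦X⟧) ^ d) n) := by
  rw [isUnit_iff_constantCoeff, qp_const d hd]; exact isUnit_one

lemma qb_congr (d : ℕ) (hd : 1 ≤ d) (n k m L : ℕ) (hk : k ≤ n) (h1 : m ≤ k) (h2 : m ≤ n - k)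
    (h3 : m ≤ L) :
    (X : R⟦X⟧) ^ (m + 1) ∣ qb ((X : R⟦X⟧) ^ d) n k * qp (X ^ d) L - 1 := by
  obtain ⟨a, ha⟩ := qp_congr (R := R) d hd m k h1
  obtain ⟨b, hb⟩ := qp_congr (R := R) d hd m (n - k) h2
  obtain ⟨l, hl⟩ := qp_congr (R := R) d hd m L h3
  obtain ⟨c, hc⟩ := qp_congr (R := R) d hd m n (by omega)
  have h := qb_mul ((X : R⟦X⟧) ^ d) n k (n - k) (by omega)
  rw [← (qp_unit (R := R) d hd m).dvd_mul_left]
  rw [sub_eq_iff_eq_add] at ha hb hl hc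
  rw [ha, hb, hc] at h
  rw [hl]
  set u := qp ((X : R⟦X⟧) ^ d) m
  set B := qb ((X : R⟦X⟧) ^ d) n k
  set Z := (X : R⟦X⟧) ^ (m + 1)
  exact ⟨c + B * u * l - B * (u * b + a * u + Z * a * b), by linear_combination h⟩

/-- partial theta sums -/
def TS {R : Type*} [CommRing R] (x y : R) (N : ℕ) : R :=
  ∑ k ∈ range (2 * N + 1), eterm x y ((k : ℤ) - N)

lemma eterm_dvd (α β : ℕ) (hα : 1 ≤ α) (hβ : 1 ≤ β) (j : ℤ) :
    (X : R⟦X⟧) ^ j.natAbs ∣ eterm ((X : R⟦X⟧) ^ α) (X ^ β) j := by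
  unfold eterm
  apply Dvd.dvd.mul_left
  rw [← pow_mul, ← pow_mul, ← pow_add]
  apply pow_dvd_pow
  have h1 := tri_cast j
  have h2 := tri_cast (j - 1)
  have h3 : (tri (j - 1) + tri j : ℤ) = j.natAbs * j.natAbs := by
    have := abs_mul_abs_self j
    rw [Int.natCast_natAbs]
    nlinarith
  have h4 : tri (j - 1) + tri j = j.natAbs * j.natAbs := by exact_mod_cast h3
  have h5 := Nat.le_mul_self j.natAbs
  have h6 : tri (j - 1) ≤ α * tri (j - 1) := Nat.le_mul_of_pos_left _ hα
  have h7 : tri j ≤ β * tri j := Nat.le_mul_of_pos_left _ hβ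
  omega

lemma jtp_lim (α β : ℕ) (hα : 1 ≤ α) (hβ : 1 ≤ β) (N L : ℕ) (hL : N ≤ L) :
    (X : R⟦X⟧) ^ (N + 1) ∣
      (∏ i ∈ range N, ((1 - ((X : R⟦X⟧) ^ α) ^ (i + 1) * (X ^ β) ^ i) *
        (1 - (X ^ α) ^ i * (X ^ β) ^ (i + 1)))) * qp (X ^ (α + β)) L - TS (X ^ α) (X ^ β) N := by
  rw [← finite_jtp]
  unfold SS TS
  rw [sum_mul, ← sum_sub_distrib, ← pow_add]
  apply dvd_sum
  intro k hk
  rw [mem_range] at hk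
  have h1 := eterm_dvd (R := R) α β hα hβ ((k : ℤ) - N)
  have h2 := qb_congr (R := R) (α + β) (by omega) (2 * N) k (N - ((k : ℤ) - N).natAbs) L
    (by omega) (by omega) (by omega) (by omega)
  have h3 := mul_dvd_mul h1 h2
  rw [← pow_add] at h3
  refine (pow_dvd_pow _ ?_).trans (h3.trans (dvd_of_eq ?_))
  · omega
  · ring

/-- The infinite product `∏ (1 - X ^ (d * m))`. -/
noncomputable def ef (R : Type*) [CommRing R] (d : ℕ) : R⟦X⟧ :=
  PowerSeries.mk fun n => coeff n (qp ((X : R⟦X⟧) ^ d) n)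

lemma ef_congr (d : ℕ) (hd : 1 ≤ d) (L : ℕ) :
    (X : R⟦X⟧) ^ (L + 1) ∣ ef R d - qp (X ^ d) L := by
  rw [X_pow_dvd_iff]
  intro m hm
  have := X_pow_dvd_iff.1 (qp_congr (R := R) d hd m L (by omega)) m (by omega)
  rw [map_sub] at this ⊢
  rw [ef, coeff_mk]
  rw [sub_eq_zero] at this ⊢
  exact this.symm

lemma ef_const (d : ℕ) : constantCoeff (ef R d) = 1 := by
  rw [← coeff_zero_eq_constantCoeff_apply, ef, coeff_mk]
  simp [qp]

lemma eq_of_forall_dvd (A B : R⟦X⟧) (h : ∀ N : ℕ, (X : R⟦X⟧) ^ (N + 1) ∣ A - B) : A = B := by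
  ext n
  have := X_pow_dvd_iff.1 (h n) n (by omega)
  rwa [map_sub, sub_eq_zero] at this

end limits

section char3

local notation "S3" => PowerSeries (ZMod 3)

instance : CharP S3 3 := by
  apply charP_of_injective_algebraMap (R := ZMod 3) (A := S3)
  exact (algebraMap (ZMod 3) S3).injective

instance : Fact (Nat.Prime 3) := ⟨Nat.prime_three⟩

lemma three_zero : (3 : S3) = 0 := by exact_mod_cast CharP.cast_eq_zero S3 3

lemma qp_cube (d n : ℕ) : qp ((X : S3) ^ (3 * d)) n = qp (X ^ d) n ^ 3 := by
  unfold qp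
  rw [← prod_pow]
  apply prod_congr rfl
  intro i _
  rw [sub_pow_char (p := 3)]
  ring

lemma sum_three {M : Type*} [AddCommMonoid M] (g : ℕ → M) (n : ℕ) :
    ∑ k ∈ range (3 * n), g k = ∑ m ∈ range n, (g (3 * m) + g (3 * m + 1) + g (3 * m + 2)) := by
  induction n with
  | zero => simp
  | succ n ih =>
    rw [sum_range_succ _ n, ← ih, show 3 * (n + 1) = 3 * n + 1 + 1 + 1 by ring,
      sum_range_succ, sum_range_succ, sum_range_succ]
    simp only [add_assoc]

lemma sgn_three (j : ℤ) : (-1 : S3) ^ (3 * j).natAbs = (-1) ^ j.natAbs := by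
  rw [Int.natAbs_mul, pow_mul]; norm_num

lemma sgn_cube (j : ℤ) : ((-1 : S3) ^ j.natAbs) ^ 3 = (-1) ^ j.natAbs := by
  rw [← pow_mul, mul_comm, pow_mul]; norm_num

lemma et0 (j : ℤ) : eterm (X : S3) X (3 * j) = eterm X X j ^ 9 := by
  unfold eterm
  rw [sgn_three, mul_pow, ← pow_add, ← pow_add, ← pow_mul (X : S3)]
  have : ((-1 : S3) ^ j.natAbs) ^ 9 = (-1) ^ j.natAbs := by
    rw [show 9 = 3 * 3 by norm_num, pow_mul, sgn_cube, sgn_cube]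
  rw [this]
  congr 2
  have h1 := tri_cast j
  have h2 := tri_cast (j - 1)
  have h3 := tri_cast (3 * j)
  have h4 := tri_cast (3 * j - 1)
  zify
  linarith

lemma et1 (j : ℤ) : eterm (X : S3) X (3 * j + 1) = - X * eterm X (X ^ 5) j ^ 3 := by
  unfold eterm
  rw [sgn_succ, sgn_three, mul_pow, ← pow_add, ← pow_mul (X : S3), ← pow_add,
    ← pow_mul (X : S3), sgn_cube]
  have : tri (3 * j + 1 - 1) + tri (3 * j + 1) = (tri (j - 1) + 5 * tri j) * 3 + 1 := by
    have h1 := tri_cast j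
    have h2 := tri_cast (j - 1)
    have h3 := tri_cast (3 * j + 1)
    have h4 := tri_cast (3 * j + 1 - 1)
    zify
    linarith
  rw [this]; ring

lemma et2 (j : ℤ) : eterm (X : S3) X (3 * j - 1) = - X * eterm X (X ^ 5) (-j) ^ 3 := by
  unfold eterm
  have hs := sgn_succ (R := S3) (3 * j - 1)
  rw [sub_add_cancel, sgn_three] at hs
  rw [mul_pow, ← pow_add, ← pow_mul (X : S3), ← pow_add, ← pow_mul (X : S3),
    sgn_cube, Int.natAbs_neg, hs]
  have : tri (3 * j - 1 - 1) + tri (3 * j - 1) = (tri (-j - 1) + 5 * tri (-j)) * 3 + 1 := by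
    have h1 := tri_cast (-j)
    have h2 := tri_cast (-j - 1)
    have h3 := tri_cast (3 * j - 1)
    have h4 := tri_cast (3 * j - 1 - 1)
    zify
    linarith
  rw [this]; ring

lemma TS_dissect (N : ℕ) :
    TS (X : S3) X (3 * N + 1) = TS X X N ^ 9 + X * TS X (X ^ 5) N ^ 3 := by
  have hsum : ∀ g : ℕ → S3, (∑ k ∈ range (2 * N + 1), g k) ^ 3 =
      ∑ k ∈ range (2 * N + 1), g k ^ 3 := fun g => sum_pow_char 3 _ _
  have href : ∑ k ∈ range (2 * N + 1), eterm (X : S3) (X ^ 5) (-((k : ℤ) - N)) ^ 3 =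
      ∑ k ∈ range (2 * N + 1), eterm (X : S3) (X ^ 5) ((k : ℤ) - N) ^ 3 := by
    rw [← sum_range_reflect]
    apply sum_congr rfl
    intro k hk
    rw [mem_range] at hk
    congr 2
    omega
  unfold TS
  rw [show 2 * (3 * N + 1) + 1 = 3 * (2 * N + 1) by ring, sum_three]
  rw [show 9 = 3 * 3 by norm_num, pow_mul, hsum, hsum, hsum]
  have : ∀ m ∈ range (2 * N + 1),
      (eterm (X : S3) X (((3 * m : ℕ) : ℤ) - ((3 * N + 1 : ℕ) : ℤ)) +
       eterm X X (((3 * m + 1 : ℕ) : ℤ) - ((3 * N + 1 : ℕ) : ℤ)) +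
       eterm X X (((3 * m + 2 : ℕ) : ℤ) - ((3 * N + 1 : ℕ) : ℤ))) =
      - X * eterm X (X ^ 5) (-((m : ℤ) - N)) ^ 3 + (eterm X X ((m : ℤ) - N) ^ 3) ^ 3
        + - X * eterm X (X ^ 5) ((m : ℤ) - N) ^ 3 := by
    intro m _
    rw [← et2, ← et1, ← pow_mul, ← et0]
    rw [show (((3 * m : ℕ) : ℤ) - ((3 * N + 1 : ℕ) : ℤ)) = 3 * ((m : ℤ) - N) - 1 by
        push_cast; ring,
      show (((3 * m + 1 : ℕ) : ℤ) - ((3 * N + 1 : ℕ) : ℤ)) = 3 * ((m : ℤ) - N) by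
        push_cast; ring,
      show (((3 * m + 2 : ℕ) : ℤ) - ((3 * N + 1 : ℕ) : ℤ)) = 3 * ((m : ℤ) - N) + 1 by
        push_cast; ring]
  rw [sum_congr rfl this, sum_add_distrib, sum_add_distrib, ← mul_sum, ← mul_sum, href]
  linear_combination (-X * ∑ k ∈ range (2 * N + 1), eterm (X : S3) (X ^ 5) ((k : ℤ) - N) ^ 3) *
    three_zero

lemma fin_phi (N : ℕ) :
    (∏ i ∈ range N, ((1 - ((X : S3) ^ 1) ^ (i + 1) * (X ^ 1) ^ i) *
        (1 - (X ^ 1) ^ i * (X ^ 1) ^ (i + 1)))) * qp (X ^ (1 + 1)) N * qp (X ^ 2) N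
      = qp (X ^ 1) (2 * N) ^ 2 := by
  induction N with
  | zero => simp [qp]
  | succ N ih =>
    rw [prod_range_succ, qp_succ, show 2 * (N + 1) = 2 * N + 1 + 1 by ring, qp_succ,
      qp_succ, mul_pow, mul_pow, ← ih]
    ring

lemma fin_omega (N : ℕ) :
    (∏ i ∈ range N, ((1 - ((X : S3) ^ 1) ^ (i + 1) * (X ^ 5) ^ i) *
        (1 - (X ^ 1) ^ i * (X ^ 5) ^ (i + 1)))) * qp (X ^ (1 + 5)) N * qp (X ^ 2) (3 * N)
          * qp (X ^ 3) (2 * N)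
      = qp (X ^ 1) (6 * N) * qp (X ^ 6) N ^ 2 := by
  induction N with
  | zero => simp [qp]
  | succ N ih =>
    rw [prod_range_succ, qp_succ _ N, show 2 * (N + 1) = 2 * N + 1 + 1 by ring,
      show 3 * (N + 1) = 3 * N + 1 + 1 + 1 by ring,
      show 6 * (N + 1) = 6 * N + 1 + 1 + 1 + 1 + 1 + 1 by ring]
    simp only [qp_succ _ (2 * N + 1), qp_succ _ (2 * N), qp_succ _ (3 * N), qp_succ _ (3 * N + 1),
      qp_succ _ (3 * N + 1 + 1), qp_succ _ (6 * N), qp_succ _ (6 * N + 1),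
      qp_succ _ (6 * N + 1 + 1), qp_succ _ (6 * N + 1 + 1 + 1),
      qp_succ _ (6 * N + 1 + 1 + 1 + 1), qp_succ _ (6 * N + 1 + 1 + 1 + 1 + 1)]
    obtain ⟨W, hW⟩ : ∃ W : ℕ → S3, ∀ c, W c = 1 - X ^ (6 * N + c) := ⟨_, fun _ => rfl⟩
    have w1 : 1 - ((X : S3) ^ 1) ^ (N + 1) * (X ^ 5) ^ N = W 1 := by rw [hW]; ring
    have w2 : 1 - ((X : S3) ^ 1) ^ N * (X ^ 5) ^ (N + 1) = W 5 := by rw [hW]; ring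
    have w3 : 1 - ((X : S3) ^ (1 + 5)) ^ (N + 1) = W 6 := by rw [hW]; ring
    have w4 : 1 - ((X : S3) ^ 2) ^ (3 * N + 1) = W 2 := by rw [hW]; ring
    have w5 : 1 - ((X : S3) ^ 2) ^ (3 * N + 1 + 1) = W 4 := by rw [hW]; ring
    have w6 : 1 - ((X : S3) ^ 2) ^ (3 * N + 1 + 1 + 1) = W 6 := by rw [hW]; ring
    have w7 : 1 - ((X : S3) ^ 3) ^ (2 * N + 1) = W 3 := by rw [hW]; ring
    have w8 : 1 - ((X : S3) ^ 3) ^ (2 * N + 1 + 1) = W 6 := by rw [hW]; ring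
    have v1 : 1 - ((X : S3) ^ 1) ^ (6 * N + 1) = W 1 := by rw [hW]; ring
    have v2 : 1 - ((X : S3) ^ 1) ^ (6 * N + 1 + 1) = W 2 := by rw [hW]; ring
    have v3 : 1 - ((X : S3) ^ 1) ^ (6 * N + 1 + 1 + 1) = W 3 := by rw [hW]; ring
    have v4 : 1 - ((X : S3) ^ 1) ^ (6 * N + 1 + 1 + 1 + 1) = W 4 := by rw [hW]; ring
    have v5 : 1 - ((X : S3) ^ 1) ^ (6 * N + 1 + 1 + 1 + 1 + 1) = W 5 := by rw [hW]; ring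
    have v6 : 1 - ((X : S3) ^ 1) ^ (6 * N + 1 + 1 + 1 + 1 + 1 + 1) = W 6 := by rw [hW]; ring
    rw [w1, w2, w3, w4, w5, w6, w7, w8, v1, v2, v3, v4, v5, v6]
    linear_combination W 1 * W 2 * W 3 * W 4 * W 5 * W 6 ^ 3 * ih

lemma key : ef (ZMod 3) 1 ^ 8 * ef (ZMod 3) 2 ^ 8 =
    ef (ZMod 3) 1 ^ 24 + X * ef (ZMod 3) 2 ^ 24 := by
  have hne : ef (ZMod 3) 1 ≠ 0 := by
    intro h
    have := ef_const (R := ZMod 3) 1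
    rw [h] at this
    simp at this
  apply mul_left_cancel₀ (pow_ne_zero 3 hne)
  apply eq_of_forall_dvd
  intro N
  set I : Ideal S3 := Ideal.span {X ^ (N + 1)} with hI
  have toI : ∀ (M : ℕ) (A B : S3), N ≤ M → X ^ (M + 1) ∣ A - B →
      Ideal.Quotient.mk I A = Ideal.Quotient.mk I B := by
    intro M A B hM h
    rw [Ideal.Quotient.mk_eq_mk_iff_sub_mem, hI, Ideal.mem_span_singleton]
    exact (pow_dvd_pow _ (by omega)).trans h
  rw [← Ideal.mem_span_singleton, ← hI, ← Ideal.Quotient.mk_eq_mk_iff_sub_mem]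
  set π := Ideal.Quotient.mk I with hπ
  have hef : ∀ d L, 1 ≤ d → N ≤ L → π (qp (X ^ d) L) = π (ef (ZMod 3) d) := fun d L hd hL =>
    (toI L _ _ hL (ef_congr d hd L)).symm
  have phi : ∀ M, N ≤ M → π (TS X X M) * π (ef (ZMod 3) 2) = π (ef (ZMod 3) 1) ^ 2 := by
    intro M hM
    have h1 := toI M _ _ hM (jtp_lim (R := ZMod 3) 1 1 le_rfl le_rfl M M le_rfl)
    have h2 := congrArg π (fin_phi M)
    rw [map_mul, h1, map_pow, hef 2 M (by omega) hM, hef 1 (2 * M) (by omega) (by omega)] at h2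
    simpa using h2
  have omg : π (TS X (X ^ 5) N) * π (ef (ZMod 3) 2) * π (ef (ZMod 3) 1) ^ 3 =
      π (ef (ZMod 3) 1) * π (ef (ZMod 3) 2) ^ 6 := by
    have h1 := toI N _ _ le_rfl (jtp_lim (R := ZMod 3) 1 5 le_rfl (by omega) N N le_rfl)
    have h2 := congrArg π (fin_omega N)
    rw [map_mul, map_mul, h1, show qp ((X : S3) ^ 3) (2 * N) = qp (X ^ 1) (2 * N) ^ 3 from
      qp_cube 1 _, show qp ((X : S3) ^ 6) N = qp (X ^ 2) N ^ 3 from qp_cube 2 _] at h2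
    rw [map_mul, map_pow, map_pow, map_pow, hef 2 N (by omega) le_rfl,
      hef 2 (3 * N) (by omega) (by omega),
      hef 1 (2 * N) (by omega) (by omega), hef 1 (6 * N) (by omega) (by omega), ← pow_mul] at h2
    simpa using h2
  have p1 := phi N le_rfl
  have p2 := phi (3 * N + 1) (by omega)
  rw [TS_dissect] at p2
  simp only [map_mul, map_add, map_pow] at p2 ⊢
  generalize π (TS X X N) = s at *
  generalize π (TS X (X ^ 5) N) = o at *
  generalize π (ef (ZMod 3) 1) = f at *
  generalize π (ef (ZMod 3) 2) = g at *
  have p3 := congrArg (· ^ 9) p1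
  have p4 := congrArg (· ^ 3) omg
  beta_reduce at p3 p4
  linear_combination f ^ 9 * p3 + π X * g ^ 6 * p4 - f ^ 9 * g ^ 8 * p2

end char3

section count

/-- multisets of parts taken from `S` with total size `n` -/
def MS (S : Finset (ℕ × ℕ)) (n : ℕ) : Set (Multiset (ℕ × ℕ)) :=
  {s | (∀ p ∈ s, p ∈ S) ∧ (s.map Prod.fst).sum = n}

lemma card_le_sum (s : Multiset (ℕ × ℕ)) (h : ∀ p ∈ s, 0 < p.1) :
    s.card ≤ (s.map Prod.fst).sum := by
  induction s using Multiset.induction with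
  | empty => simp
  | cons p s ih =>
    have h1 := h p (Multiset.mem_cons_self p s)
    have h2 := ih fun q hq => h q (Multiset.mem_cons_of_mem hq)
    simp only [Multiset.card_cons, Multiset.map_cons, Multiset.sum_cons]
    omega

lemma MS_finite (S : Finset (ℕ × ℕ)) (hS : ∀ p ∈ S, 0 < p.1) (n : ℕ) : (MS S n).Finite := by
  apply (Set.finite_Iic (n • S.val)).subset
  rintro s ⟨h1, h2⟩
  rw [Set.mem_Iic, Multiset.le_iff_count]
  intro p
  rw [Multiset.count_nsmul]
  by_cases hp : p ∈ s
  · have h3 := card_le_sum s fun q hq => hS q (h1 q hq)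
    have h4 := Multiset.count_le_card p s
    have h5 : 1 ≤ Multiset.count p S.val := Multiset.one_le_count_iff_mem.2 (h1 p hp)
    nlinarith
  · rw [Multiset.count_eq_zero_of_notMem hp]; exact Nat.zero_le _

lemma MS_insert (S : Finset (ℕ × ℕ)) (hS : ∀ p ∈ S, 0 < p.1) (p : ℕ × ℕ) (hp : p ∉ S)
    (hp0 : 0 < p.1) (n : ℕ) : (MS (insert p S) n).ncard =
      (MS S n).ncard + if p.1 ≤ n then (MS (insert p S) (n - p.1)).ncard else 0 := by
  have hS' : ∀ q ∈ insert p S, 0 < q.1 := by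
    intro q hq
    rcases Finset.mem_insert.1 hq with rfl | h
    · exact hp0
    · exact hS q h
  split_ifs with hn
  · have hE : MS (insert p S) n = MS S n ∪ (fun s => p ::ₘ s) '' MS (insert p S) (n - p.1) := by
      ext s
      constructor
      · rintro ⟨h1, h2⟩
        by_cases hps : p ∈ s
        · right
          obtain ⟨u, rfl⟩ := Multiset.exists_cons_of_mem hps
          refine ⟨u, ⟨fun q hq => h1 q (Multiset.mem_cons_of_mem hq), ?_⟩, rfl⟩
          simp only [Multiset.map_cons, Multiset.sum_cons] at h2
          omega
        · left
          refine ⟨fun q hq => ?_, h2⟩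
          rcases Finset.mem_insert.1 (h1 q hq) with rfl | h
          · exact absurd hq hps
          · exact h
      · rintro (⟨h1, h2⟩ | ⟨u, ⟨h1, h2⟩, rfl⟩)
        · exact ⟨fun q hq => Finset.mem_insert_of_mem (h1 q hq), h2⟩
        · refine ⟨fun q hq => ?_, ?_⟩
          · rcases Multiset.mem_cons.1 hq with rfl | h
            · exact Finset.mem_insert_self _ _
            · exact h1 q h
          · simp only [Multiset.map_cons, Multiset.sum_cons]; omega
    have hdis : Disjoint (MS S n) ((fun s => p ::ₘ s) '' MS (insert p S) (n - p.1)) := by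
      rw [Set.disjoint_left]
      rintro s ⟨h1, _⟩ ⟨u, _, rfl⟩
      exact hp (h1 p (Multiset.mem_cons_self p u))
    rw [hE, Set.ncard_union_eq hdis (MS_finite S hS n) ((MS_finite _ hS' _).image _),
      Set.ncard_image_of_injective _ (fun a b h => (Multiset.cons_inj_right p).1 h)]
  · rw [add_zero]
    congr 1
    ext s
    constructor
    · rintro ⟨h1, h2⟩
      refine ⟨fun q hq => ?_, h2⟩
      rcases Finset.mem_insert.1 (h1 q hq) with rfl | h
      · have : q.1 ≤ (s.map Prod.fst).sum :=
          Multiset.single_le_sum (fun _ _ => Nat.zero_le _) _ (Multiset.mem_map_of_mem _ hq)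
        omega
      · exact h
    · rintro ⟨h1, h2⟩
      exact ⟨fun q hq => Finset.mem_insert_of_mem (h1 q hq), h2⟩

variable (R : Type*) [CommRing R]

/-- generating series of `MS` -/
noncomputable def GS (S : Finset (ℕ × ℕ)) : R⟦X⟧ :=
  PowerSeries.mk fun n => ((MS S n).ncard : R)

lemma GS_mul (S : Finset (ℕ × ℕ)) (hS : ∀ p ∈ S, 0 < p.1) :
    GS R S * ∏ p ∈ S, (1 - (X : R⟦X⟧) ^ p.1) = 1 := by
  induction S using Finset.induction_on with
  | empty =>
    rw [Finset.prod_empty, mul_one]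
    ext n
    rw [GS, coeff_mk, coeff_one]
    split_ifs with h
    · have : MS ∅ n = {0} := by
        ext s
        simp only [MS, Finset.notMem_empty, Set.mem_ofPred_eq, Set.mem_singleton_iff]
        constructor
        · rintro ⟨h1, _⟩; exact Multiset.eq_zero_of_forall_notMem h1
        · rintro rfl; simp [h]
      rw [this]; simp
    · have : MS ∅ n = ∅ := by
        ext s
        simp only [MS, Finset.notMem_empty, Set.mem_ofPred_eq, Set.mem_empty_iff_false, iff_false]
        rintro ⟨h1, h2⟩
        rw [Multiset.eq_zero_of_forall_notMem h1] at h2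
        simp at h2
        omega
      rw [this]; simp
  | insert p S hp ih =>
    have h0 : ∀ q ∈ S, 0 < q.1 := fun q hq => hS q (Finset.mem_insert_of_mem hq)
    have hp0 := hS p (Finset.mem_insert_self _ _)
    have h1 : GS R (insert p S) * (1 - X ^ p.1) = GS R S := by
      ext n
      rw [mul_sub, mul_one, map_sub, coeff_mul_X_pow', GS, GS, coeff_mk, coeff_mk, coeff_mk,
        MS_insert S h0 p hp hp0 n]
      split_ifs <;> simp
    rw [Finset.prod_insert hp, ← mul_assoc, h1, ih h0]

/-- the allowed parts of size at most `L` -/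
def parts (k L : ℕ) : Finset (ℕ × ℕ) :=
  (Finset.Icc 1 L ×ˢ Finset.Icc 1 k).filter fun p => Even p.1 → p.2 = 1

lemma parts_pos (k L : ℕ) : ∀ p ∈ parts k L, 0 < p.1 := by
  intro p hp
  simp only [parts, Finset.mem_filter, Finset.mem_product, Finset.mem_Icc] at hp
  omega

lemma MS_parts (k L n : ℕ) (h : n ≤ L) : MS (parts k L) n = coloredOddPartitions k n := by
  ext s
  simp only [MS, coloredOddPartitions, Set.mem_ofPred_eq]
  refine and_congr_left fun hs => forall₂_congr fun p hp => ?_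
  have : p.1 ≤ (s.map Prod.fst).sum :=
    Multiset.single_le_sum (fun _ _ => Nat.zero_le _) _ (Multiset.mem_map_of_mem _ hp)
  simp only [parts, Finset.mem_filter, Finset.mem_product, Finset.mem_Icc]
  constructor
  · rintro ⟨⟨⟨h1, h2⟩, h3, h4⟩, h5⟩
    exact ⟨h1, h3, h4, h5⟩
  · rintro ⟨h1, h3, h4, h5⟩
    exact ⟨⟨⟨h1, by omega⟩, h3, h4⟩, h5⟩

lemma parts_prod (k N : ℕ) :
    (∏ p ∈ parts (k + 1) (2 * N), (1 - (X : R⟦X⟧) ^ p.1)) * qp (X ^ 2) N ^ k =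
      qp (X ^ 1) (2 * N) ^ (k + 1) := by
  unfold parts
  rw [Finset.prod_filter, Finset.prod_product]
  induction N with
  | zero => simp [qp]
  | succ N ih =>
    rw [show 2 * (N + 1) = 2 * N + 1 + 1 by ring, Finset.prod_Icc_succ_top (by omega),
      Finset.prod_Icc_succ_top (by omega), qp_succ, qp_succ, qp_succ, mul_pow, mul_pow, mul_pow,
      ← ih]
    have e1 : (∏ c ∈ Finset.Icc 1 (k + 1), if Even (2 * N + 1) → c = 1 then
        (1 - (X : R⟦X⟧) ^ (2 * N + 1)) else 1) = (1 - (X : R⟦X⟧) ^ (2 * N + 1)) ^ (k + 1) := by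
      have : ¬ Even (2 * N + 1) := by simp
      simp [this]
    have e2 : (∏ c ∈ Finset.Icc 1 (k + 1), if Even (2 * N + 1 + 1) → c = 1 then
        (1 - (X : R⟦X⟧) ^ (2 * N + 1 + 1)) else 1) = (1 - (X : R⟦X⟧) ^ (2 * N + 1 + 1)) := by
      have : Even (2 * N + 1 + 1) := ⟨N + 1, by ring⟩
      simp [this]
    simp only at e1 e2 ⊢
    rw [e1, e2, pow_one, ← pow_mul, show 2 * (N + 1) = 2 * N + 1 + 1 by ring]
    ring

/-- generating series of `a k` -/
noncomputable def AS (k : ℕ) : R⟦X⟧ := PowerSeries.mk fun n => (a k n : R)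

lemma AS_mul (k : ℕ) : AS R (k + 1) * ef R 1 ^ (k + 1) = ef R 2 ^ k := by
  apply eq_of_forall_dvd
  intro N
  set I : Ideal R⟦X⟧ := Ideal.span {X ^ (N + 1)} with hI
  have toI : ∀ (M : ℕ) (A B : R⟦X⟧), N ≤ M → X ^ (M + 1) ∣ A - B →
      Ideal.Quotient.mk I A = Ideal.Quotient.mk I B := by
    intro M A B hM h
    rw [Ideal.Quotient.mk_eq_mk_iff_sub_mem, hI, Ideal.mem_span_singleton]
    exact (pow_dvd_pow _ (by omega)).trans h
  rw [← Ideal.mem_span_singleton, ← hI, ← Ideal.Quotient.mk_eq_mk_iff_sub_mem]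
  set π := Ideal.Quotient.mk I with hπ
  have hef : ∀ d L, 1 ≤ d → N ≤ L → π (qp (X ^ d) L) = π (ef R d) := fun d L hd hL =>
    (toI L _ _ hL (ef_congr d hd L)).symm
  have h1 : π (AS R (k + 1)) = π (GS R (parts (k + 1) (2 * N))) := by
    apply toI N _ _ le_rfl
    rw [X_pow_dvd_iff]
    intro m hm
    rw [map_sub, AS, GS, coeff_mk, coeff_mk, MS_parts _ _ _ (by omega), a, Set.ncard_def,
      sub_eq_zero]
    rfl
  have h2 := congrArg π (GS_mul R (parts (k + 1) (2 * N)) (parts_pos _ _))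
  have h3 := congrArg π (parts_prod R k N)
  simp only [map_mul, map_pow, map_one] at h2 h3 ⊢
  rw [h1]
  have e1 := hef 1 (2 * N) le_rfl (by omega)
  have e2 := hef 2 N (by omega) le_rfl
  rw [e1, e2] at h3
  rw [← h3, ← mul_assoc, h2, one_mul]

end count

section final

local notation "S3" => PowerSeries (ZMod 3)

lemma coeff_cube (A : S3) (m : ℕ) :
    coeff m (A ^ 3) = if 3 ∣ m then coeff (m / 3) A else 0 := by
  have h : (A.expand 3 (by norm_num)).map (frobenius (ZMod 3) 3) = A ^ 3 :=
    MvPowerSeries.map_frobenius_expand 3 (by norm_num)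
  rw [← h, ZMod.frobenius_zmod, PowerSeries.map_id, id_eq, coeff_expand]

lemma u0 (A B C : S3) (n : ℕ) :
    coeff (3 * n) (A ^ 3 + X * B ^ 3 + X ^ 2 * C ^ 3) = coeff n A := by
  rw [map_add, map_add, coeff_X_pow_mul', ← pow_one X, coeff_X_pow_mul', coeff_cube, coeff_cube,
    coeff_cube, if_pos (by omega), show 3 * n / 3 = n by omega]
  have h1 : ¬ (1 ≤ 3 * n ∧ 3 ∣ 3 * n - 1) := by omega
  have h2 : ¬ (2 ≤ 3 * n ∧ 3 ∣ 3 * n - 2) := by omega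
  rw [← ite_and, ← ite_and, if_neg h1, if_neg h2]; simp

lemma u1 (A B C : S3) (n : ℕ) :
    coeff (3 * n + 1) (A ^ 3 + X * B ^ 3 + X ^ 2 * C ^ 3) = coeff n B := by
  rw [map_add, map_add, coeff_X_pow_mul', ← pow_one X, coeff_X_pow_mul', coeff_cube, coeff_cube,
    coeff_cube, if_neg (by omega), if_pos (by omega), if_pos (by omega)]
  have h2 : ¬ (2 ≤ 3 * n + 1 ∧ 3 ∣ 3 * n + 1 - 2) := by omega
  rw [← ite_and, if_neg h2, show (3 * n + 1 - 1) / 3 = n by omega]; simp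

lemma u2 (A B C : S3) (n : ℕ) :
    coeff (3 * n + 2) (A ^ 3 + X * B ^ 3 + X ^ 2 * C ^ 3) = coeff n C := by
  rw [map_add, map_add, coeff_X_pow_mul', ← pow_one X, coeff_X_pow_mul', coeff_cube, coeff_cube,
    coeff_cube, if_neg (by omega), if_pos (by omega), if_neg (by omega), if_pos (by omega),
    if_pos (by omega), show (3 * n + 2 - 2) / 3 = n by omega]; simp

lemma exists_forms : ∃ p D : S3, p ^ 8 * (1 + X * D ^ 24) = 1 ∧
    ∀ t, AS (ZMod 3) (3 * t + 2) = p ^ 15 * D ^ (3 * t) * (1 + X * D ^ 24) ^ 2 := by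
  have hc1 := ef_const (R := ZMod 3) 1
  have hc2 := ef_const (R := ZMod 3) 2
  have hk := key
  have hA := fun t => AS_mul (ZMod 3) (3 * t + 1)
  set f := ef (ZMod 3) 1
  set g := ef (ZMod 3) 2
  have hf : f * f⁻¹ = 1 := PowerSeries.mul_inv_cancel f (by rw [hc1]; exact one_ne_zero)
  have hg : g * g⁻¹ = 1 := PowerSeries.mul_inv_cancel g (by rw [hc2]; exact one_ne_zero)
  have hf0 : f ≠ 0 := left_ne_zero_of_mul_eq_one hf
  have hg0 : g ≠ 0 := left_ne_zero_of_mul_eq_one hg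
  obtain ⟨D, hD⟩ : ∃ D : S3, D * f = g := ⟨g * f⁻¹, by linear_combination g * hf⟩
  obtain ⟨p, hp⟩ : ∃ p : S3, p * g = f ^ 2 := ⟨f ^ 2 * g⁻¹, by linear_combination f ^ 2 * hg⟩
  have h1 : p ^ 8 * (1 + X * D ^ 24) = 1 := by
    apply mul_left_cancel₀ (mul_ne_zero (pow_ne_zero 24 hf0) (pow_ne_zero 8 hg0))
    calc f ^ 24 * g ^ 8 * (p ^ 8 * (1 + X * D ^ 24))
        = (p * g) ^ 8 * (f ^ 24 + X * (D * f) ^ 24) := by ring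
      _ = (f ^ 2) ^ 8 * (f ^ 8 * g ^ 8) := by rw [hp, hD, hk]
      _ = _ := by ring
  refine ⟨p, D, h1, fun t => ?_⟩
  apply mul_right_cancel₀ (pow_ne_zero (3 * t + 1 + 1) hf0)
  rw [hA t]
  symm
  calc p ^ 15 * D ^ (3 * t) * (1 + X * D ^ 24) ^ 2 * f ^ (3 * t + 1 + 1)
      = p ^ 15 * (D * f) ^ (3 * t) * (1 + X * D ^ 24) ^ 2 * f ^ 2 := by ring
    _ = (p ^ 8 * (1 + X * D ^ 24)) ^ 2 * g ^ (3 * t + 1) := by rw [hD, ← hp]; ring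
    _ = _ := by rw [h1]; ring

end final
end ColOdd

open PowerSeries ColOdd
theorem stmt4 (t n : ℕ) (ht : t ≤ 8) :
    a (3 * t + 2) (27 * n + (if Even t then t else t + 9)) ≡
      a (3 * t + 2) (3 * n + (if Even t then 0 else 1)) [MOD 3] := by
  rw [← ZMod.natCast_eq_natCast_iff]
  obtain ⟨p, D, h1, hA⟩ := exists_forms
  have hcoe : ∀ m, ((a (3 * t + 2) m : ℕ) : ZMod 3) = coeff m (AS (ZMod 3) (3 * t + 2)) := by
    intro m; rw [AS, coeff_mk]
  rw [hcoe, hcoe, hA]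
  have hF : ∀ t : ℕ, p ^ 15 * D ^ (3 * t) * (1 + X * D ^ 24) ^ 2 =
      (p ^ 5 * D ^ t) ^ 3 + X * (- (p ^ 5 * D ^ (8 + t))) ^ 3 +
        X ^ 2 * (p ^ 5 * D ^ (16 + t)) ^ 3 := by
    intro t
    linear_combination (X * p ^ 15 * D ^ (24 + 3 * t)) * three_zero
  have hH : ∀ s : ℕ, p ^ 5 * D ^ (3 * s) =
      (p ^ 7 * D ^ s) ^ 3 + X * (- (p ^ 7 * D ^ (8 + s))) ^ 3 +
        X ^ 2 * (p ^ 7 * D ^ (16 + s)) ^ 3 := by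
    intro s
    have h2 : p ^ 5 = p ^ 21 * (1 + X * D ^ 24) ^ 2 := by
      linear_combination (- p ^ 5 * (1 + p ^ 8 * (1 + X * D ^ 24))) * h1
    rw [h2]
    linear_combination (X * p ^ 21 * D ^ (24 + 3 * s)) * three_zero
  have hK : ∀ t : ℕ, p ^ 7 * D ^ (3 * t) =
      (p ^ 5 * D ^ t) ^ 3 + X * (p ^ 5 * D ^ (8 + t)) ^ 3 + X ^ 2 * 0 ^ 3 := by
    intro t
    linear_combination (- p ^ 7 * D ^ (3 * t)) * h1
  rw [hF]
  have hH' : ∀ s m, m = 3 * s → p ^ 5 * D ^ m = _ := fun s m h => h ▸ hH s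
  have hK' : ∀ s m, m = 3 * s → p ^ 7 * D ^ m = _ := fun s m h => h ▸ hK s
  interval_cases t
  · rw [if_pos (by decide), if_pos (by decide), show 27 * n + 0 = 3 * (3 * (3 * n)) by ring,
      add_zero (3 * n), u0 _ _ _ n, u0, hH' 0 _ (by norm_num), u0, hK' 0 _ (by norm_num), u0,
      ← hK' 0 0 (by norm_num), ← hH' 0 0 (by norm_num)]
  · rw [if_neg (by decide), if_neg (by decide),
      show 27 * n + (1 + 9) = 3 * (3 * (3 * n + 1)) + 1 by ring,
      u1 _ _ _ n, map_neg,
      u1, map_neg, hH' 3 _ (by norm_num), u0, hK' 1 _ (by norm_num), u1,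
      ← hK' 1 3 (by norm_num), ← hH' 3 (8 + 1) (by norm_num)]
  · rw [if_pos (by decide), if_pos (by decide), show 27 * n + 2 = 3 * (3 * (3 * n)) + 2 by ring,
      add_zero (3 * n), u0 _ _ _ n, u2, hH' 6 _ (by norm_num), u0, hK' 2 _ (by norm_num), u0]
  · rw [if_neg (by decide), if_neg (by decide),
      show 27 * n + (3 + 9) = 3 * (3 * (3 * n + 1) + 1) by ring,
      u1 _ _ _ n, map_neg,
      u0, hH' 1 _ (by norm_num), u1, map_neg, hK' 3 _ (by norm_num), u1]
  · rw [if_pos (by decide), if_pos (by decide),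
      show 27 * n + 4 = 3 * (3 * (3 * n) + 1) + 1 by ring,
      add_zero (3 * n), u0 _ _ _ n, u1, map_neg, hH' 4 _ (by norm_num), u1, map_neg, neg_neg, hK' 4 _ (by norm_num), u0]
  · rw [if_neg (by decide), if_neg (by decide),
      show 27 * n + (5 + 9) = 3 * (3 * (3 * n + 1) + 1) + 2 by ring,
      u1 _ _ _ n, map_neg,
      u2, hH' 7 _ (by norm_num), u1, map_neg, hK' 5 _ (by norm_num), u1]
  · rw [if_pos (by decide), if_pos (by decide),
      show 27 * n + 6 = 3 * (3 * (3 * n) + 2) by ring,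
      add_zero (3 * n), u0 _ _ _ n, u0, hH' 2 _ (by norm_num), u2, hK' 6 _ (by norm_num), u0,
      ← hK' 6 (16 + 2) (by norm_num), ← hH' 2 6 (by norm_num)]
  · rw [if_neg (by decide), if_neg (by decide),
      show 27 * n + (7 + 9) = 3 * (3 * (3 * n + 1) + 2) + 1 by ring,
      u1 _ _ _ n, map_neg,
      u1, map_neg, hH' 5 _ (by norm_num), u2, hK' 7 _ (by norm_num), u1,
      ← hK' 7 (16 + 5) (by norm_num), ← hH' 5 (8 + 7) (by norm_num)]
  · rw [if_pos (by decide), if_pos (by decide),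
      show 27 * n + 8 = 3 * (3 * (3 * n) + 2) + 2 by ring,
      add_zero (3 * n), u0 _ _ _ n, u2, hH' 8 _ (by norm_num), u2, hK' 8 _ (by norm_num), u0]
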